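/- Given channels N1, N2 with Γ(N2) = t (the SDP value defined by max tr(J R) over −ρ⊗I ≤ R^{T_B} ≤ ρ⊗I, ρ a density operator), one has F^{PPTp}(N1 ⊗ N2, k·t) ≤ F^{PPTp}(N1, k) for all k > 0. -/

import Mathlib

open Matrix
open scoped Kronecker ComplexOrder

/-- Loewner order: `Loe M N` means `M ≤ N`. -/
def Loe {n : Type*} [Fintype n] (M N : Matrix n n ℂ) : Prop := (N - M).PosSemidef

/-- Partial transpose on the second tensor factor. -/
def PTb {A B : Type*} (M : Matrix (A × B) (A × B) ℂ) : Matrix (A × B) (A × B) ℂ :=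
  fun p q => M (p.1, q.2) (q.1, p.2)

/-- Partial trace over the second tensor factor. -/
noncomputable def trB {A B : Type*} [Fintype B]
    (M : Matrix (A × B) (A × B) ℂ) : Matrix A A ℂ :=
  fun i j => ∑ b, M (i, b) (j, b)

/-- Values of the SDP `Γ(N)`. -/
def GammaSet {A B : Type*} [Fintype A] [Fintype B] [DecidableEq B]
    (J : Matrix (A × B) (A × B) ℂ) : Set ℝ :=
  {t : ℝ | ∃ (R : Matrix (A × B) (A × B) ℂ) (ρ : Matrix A A ℂ),
    R.IsHermitian ∧ ρ.PosSemidef ∧ ρ.trace = 1 ∧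
    Loe (-(ρ ⊗ₖ (1 : Matrix B B ℂ))) (PTb R) ∧
    Loe (PTb R) (ρ ⊗ₖ (1 : Matrix B B ℂ)) ∧
    (J * R).trace = (t : ℂ)}

/-- Values of the PPT-preserving fidelity SDP `F^{PPTp}(N, k)`. -/
def FSet {A B : Type*} [Fintype A] [Fintype B] [DecidableEq B]
    (J : Matrix (A × B) (A × B) ℂ) (k : ℝ) : Set ℝ :=
  {t : ℝ | ∃ (W : Matrix (A × B) (A × B) ℂ) (ρ : Matrix A A ℂ),
    ρ.PosSemidef ∧ ρ.trace = 1 ∧ W.PosSemidef ∧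
    Loe W (ρ ⊗ₖ (1 : Matrix B B ℂ)) ∧
    Loe (-(((k : ℂ))⁻¹ • (ρ ⊗ₖ (1 : Matrix B B ℂ)))) (PTb W) ∧
    Loe (PTb W) (((k : ℂ))⁻¹ • (ρ ⊗ₖ (1 : Matrix B B ℂ))) ∧
    (J * W).trace = (t : ℂ)}

/-- The Choi matrix of a tensor product channel, with factors reordered. -/
def choiTensor {A1 B1 A2 B2 : Type*}
    (J1 : Matrix (A1 × B1) (A1 × B1) ℂ) (J2 : Matrix (A2 × B2) (A2 × B2) ℂ) :
    Matrix ((A1 × A2) × (B1 × B2)) ((A1 × A2) × (B1 × B2)) ℂ :=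
  fun p q => J1 (p.1.1, p.2.1) (q.1.1, q.2.1) * J2 (p.1.2, p.2.2) (q.1.2, q.2.2)

section Pairing

variable {X U A B : Type*}

/-- The partial pairing `Tr_U[(1 ⊗ J) M]`. -/
noncomputable def partialPairing [Fintype U] (J : Matrix U U ℂ) (M : Matrix (X × U) (X × U) ℂ) :
    Matrix X X ℂ :=
  fun y x => ∑ u, ∑ v, J u v * M (y, v) (x, u)

/-- The compression `⟨φ| M |φ⟩` of `M` to the second tensor factor. -/
noncomputable def compress [Fintype X] (φ : X → ℂ) (M : Matrix (X × U) (X × U) ℂ) : Matrix U U ℂ :=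
  fun v u => ∑ y, ∑ x, star (φ y) * M (y, v) (x, u) * φ x

theorem posSemidef_of_dotProduct_mulVec_nonneg [Fintype X] {M : Matrix X X ℂ}
    (h : ∀ φ : X → ℂ, 0 ≤ star φ ⬝ᵥ (M *ᵥ φ)) : M.PosSemidef := by
  classical
  rw [← Matrix.isPositive_toEuclideanLin_iff, LinearMap.isPositive_iff_complex]
  intro φ
  have hφ := h φ.ofLp
  have e : inner ℂ (M.toEuclideanLin φ) φ = star (star φ.ofLp ⬝ᵥ (M *ᵥ φ.ofLp)) := by
    rw [EuclideanSpace.inner_eq_star_dotProduct]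
    rw [← Matrix.star_dotProduct, dotProduct_comm]
    rfl
  rw [e]
  rw [Complex.nonneg_iff] at hφ
  refine ⟨?_, by simpa using hφ.1⟩
  apply Complex.ext <;> simp [← hφ.2]

theorem trace_mul_nonneg_of_posSemidef [Fintype U] {J S : Matrix U U ℂ}
    (hJ : J.PosSemidef) (hS : S.PosSemidef) : 0 ≤ (J * S).trace := by
  classical
  obtain ⟨m, w, rfl⟩ := Matrix.posSemidef_iff_eq_sum_vecMulVec.mp hJ
  rw [Finset.sum_mul, Matrix.trace_sum]
  refine Finset.sum_nonneg fun i _ => ?_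
  rw [Matrix.vecMulVec_mul, Matrix.trace_vecMulVec, dotProduct_comm, ← Matrix.dotProduct_mulVec]
  exact hS.dotProduct_mulVec_nonneg _

theorem star_trace_mul_of_isHermitian [Fintype U] {J S : Matrix U U ℂ}
    (hJ : J.IsHermitian) (hS : S.IsHermitian) : star (J * S).trace = (J * S).trace := by
  rw [← Matrix.trace_conjTranspose, Matrix.conjTranspose_mul, hJ.eq, hS.eq,
    Matrix.trace_mul_comm]

theorem dotProduct_partialPairing_mulVec [Fintype X] [Fintype U] (J : Matrix U U ℂ)
    (M : Matrix (X × U) (X × U) ℂ) (φ : X → ℂ) :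
    star φ ⬝ᵥ (partialPairing J M *ᵥ φ) = (J * compress φ M).trace := by
  simp only [dotProduct, Matrix.mulVec, Matrix.trace, Matrix.diag, Matrix.mul_apply,
    partialPairing, compress, Finset.mul_sum, Finset.sum_mul, Pi.star_apply,
    ← Fintype.sum_prod_type']
  refine Fintype.sum_equiv
    ⟨fun p => (p.2.2.1, p.2.2.2, p.1, p.2.1), fun p => (p.2.2.1, p.2.2.2, p.1, p.2.1),
      fun _ => rfl, fun _ => rfl⟩ _ _ fun _ => ?_
  simp only [Equiv.coe_fn_mk]
  ring

theorem compress_posSemidef [Fintype X] [Fintype U]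
    {M : Matrix (X × U) (X × U) ℂ} (hM : M.PosSemidef) (φ : X → ℂ) :
    (compress φ M).PosSemidef := by
  classical
  have h := hM.conjTranspose_mul_mul_same
    (Matrix.of fun (p : X × U) (u : U) => φ p.1 * (1 : Matrix U U ℂ) p.2 u)
  convert h using 1
  ext v u
  simp only [compress, Matrix.mul_apply, Matrix.conjTranspose_apply, Matrix.of_apply,
    Fintype.sum_prod_type, Matrix.one_apply]
  simp only [mul_ite, mul_one, mul_zero, apply_ite star, star_zero, ite_mul,
    zero_mul, Finset.sum_ite_eq', Finset.mem_univ, if_true, Finset.sum_mul]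
  exact Finset.sum_comm

theorem partialPairing_posSemidef [Fintype X] [Fintype U]
    {J : Matrix U U ℂ} {M : Matrix (X × U) (X × U) ℂ}
    (hJ : J.PosSemidef) (hM : M.PosSemidef) : (partialPairing J M).PosSemidef :=
  posSemidef_of_dotProduct_mulVec_nonneg fun φ => by
    rw [dotProduct_partialPairing_mulVec]
    exact trace_mul_nonneg_of_posSemidef hJ (compress_posSemidef hM φ)

theorem partialPairing_sub [Fintype U] (J : Matrix U U ℂ) (M N : Matrix (X × U) (X × U) ℂ) :
    partialPairing J (M - N) = partialPairing J M - partialPairing J N := by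
  ext y x
  simp [partialPairing, mul_sub, Finset.sum_sub_distrib]

theorem compress_sub [Fintype X] (φ : X → ℂ) (M N : Matrix (X × U) (X × U) ℂ) :
    compress φ (M - N) = compress φ M - compress φ N := by
  ext v u
  simp [compress, mul_sub, sub_mul, Finset.sum_sub_distrib]

theorem compress_smul [Fintype X] (c : ℂ) (φ : X → ℂ) (M : Matrix (X × U) (X × U) ℂ) :
    compress φ (c • M) = c • compress φ M := by
  ext v u
  simp only [compress, Matrix.smul_apply, smul_eq_mul, Finset.mul_sum]
  exact Finset.sum_congr rfl fun _ _ => Finset.sum_congr rfl fun _ _ => by ring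

theorem compress_neg [Fintype X] (φ : X → ℂ) (M : Matrix (X × U) (X × U) ℂ) :
    compress φ (-M) = -compress φ M := by
  ext v u
  simp [compress]

theorem trB_eq_partialPairing [Fintype U] [DecidableEq U] (M : Matrix (X × U) (X × U) ℂ) :
    trB M = partialPairing 1 M := by
  ext y x
  simp [trB, partialPairing, Matrix.one_apply]

theorem trB_posSemidef [Fintype X] [Fintype U] {M : Matrix (X × U) (X × U) ℂ} (hM : M.PosSemidef) :
    (trB M).PosSemidef := by
  classical
  rw [trB_eq_partialPairing]
  exact partialPairing_posSemidef .one hM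

theorem trace_trB [Fintype X] [Fintype U]
    (M : Matrix (X × U) (X × U) ℂ) : (trB M).trace = M.trace := by
  simp [Matrix.trace, trB, Fintype.sum_prod_type]

theorem trace_compress [Fintype X] [Fintype U] (φ : X → ℂ) (M : Matrix (X × U) (X × U) ℂ) :
    (compress φ M).trace = star φ ⬝ᵥ (trB M *ᵥ φ) := by
  classical
  rw [trB_eq_partialPairing, dotProduct_partialPairing_mulVec, one_mul]

theorem PTb_PTb (M : Matrix (A × B) (A × B) ℂ) : PTb (PTb M) = M := rfl

theorem PTb_isHermitian {M : Matrix (A × B) (A × B) ℂ} (hM : M.IsHermitian) :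
    (PTb M).IsHermitian := by
  ext p q
  exact congrFun (congrFun hM (p.1, q.2)) (q.1, p.2)

theorem trace_PTb_mul [Fintype A] [Fintype B] (J S : Matrix (A × B) (A × B) ℂ) :
    (PTb J * S).trace = (J * PTb S).trace := by
  simp only [Matrix.trace, Matrix.diag, Matrix.mul_apply, PTb, ← Fintype.sum_prod_type']
  refine Fintype.sum_equiv
    ⟨fun p => ((p.1.1, p.2.2), (p.2.1, p.1.2)), fun p => ((p.1.1, p.2.2), (p.2.1, p.1.2)),
      fun _ => rfl, fun _ => rfl⟩ _ _ fun _ => rfl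

theorem Loe.zero_eq [Fintype U] {S : Matrix U U ℂ} (h₁ : Loe (-0) S) (h₂ : Loe S 0) : S = 0 := by
  classical
  simp only [Loe, neg_zero, sub_zero, zero_sub] at h₁ h₂
  have h := h₂.trace_nonneg
  rw [Matrix.trace_neg] at h
  exact h₁.trace_eq_zero_iff.mp (le_antisymm (neg_nonneg.mp h) h₁.trace_nonneg)

end Pairing

section Gamma

variable {A B : Type*} [Fintype A] [Fintype B] [DecidableEq B]

theorem trace_mul_kronecker_one (J : Matrix (A × B) (A × B) ℂ) (ρ : Matrix A A ℂ) :
    (J * (ρ ⊗ₖ (1 : Matrix B B ℂ))).trace = (trB J * ρ).trace := by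
  simp only [Matrix.trace, Matrix.diag, Matrix.mul_apply, Fintype.sum_prod_type,
    Matrix.kroneckerMap_apply, Matrix.one_apply, trB, Finset.sum_mul]
  simp only [mul_ite, mul_one, mul_zero, Finset.sum_ite_eq',
    Finset.mem_univ, if_true]
  exact Finset.sum_congr rfl fun _ _ => Finset.sum_comm

theorem one_le_of_isGreatest_GammaSet [DecidableEq A] {J : Matrix (A × B) (A × B) ℂ}
    (hJTP : trB J = 1) {t : ℝ} (ht : IsGreatest (GammaSet J) t) : 1 ≤ t := by
  obtain ⟨-, ρ, -, hρ, hρ1, -⟩ := ht.1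
  have hP : (ρ ⊗ₖ (1 : Matrix B B ℂ)).PosSemidef := hρ.kronecker .one
  have hPT : PTb (ρ ⊗ₖ (1 : Matrix B B ℂ)) = ρ ⊗ₖ (1 : Matrix B B ℂ) := by
    ext p q
    simp [PTb, Matrix.one_apply, eq_comm]
  refine ht.2 ⟨ρ ⊗ₖ 1, ρ, hP.isHermitian, hρ, hρ1, ?_, ?_, ?_⟩
  · rw [hPT, Loe, sub_neg_eq_add]
    exact hP.add hP
  · rw [hPT, Loe, sub_self]
    exact .zero
  · rw [trace_mul_kronecker_one, hJTP, one_mul, hρ1, Complex.ofReal_one]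

/-- The homogeneous form of the bound expressed by `Γ`. -/
theorem trace_mul_PTb_le {J : Matrix (A × B) (A × B) ℂ} (hJ : J.IsHermitian) {t : ℝ}
    (ht : t ∈ upperBounds (GammaSet J)) {S : Matrix (A × B) (A × B) ℂ} {σ : Matrix A A ℂ}
    (hσ : σ.PosSemidef) (h₁ : Loe (-(σ ⊗ₖ (1 : Matrix B B ℂ))) S)
    (h₂ : Loe S (σ ⊗ₖ (1 : Matrix B B ℂ))) :
    (J * PTb S).trace ≤ t * σ.trace := by
  classical
  obtain h0 | h0 := eq_or_ne σ.trace 0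
  · obtain rfl := hσ.trace_eq_zero_iff.mp h0
    rw [Matrix.zero_kronecker] at h₁ h₂
    obtain rfl := Loe.zero_eq h₁ h₂
    have : PTb (0 : Matrix (A × B) (A × B) ℂ) = 0 := rfl
    simp [this]
  obtain ⟨s, hs⟩ : ∃ s : ℝ, σ.trace = s := ⟨σ.trace.re, by
    have := (Complex.nonneg_iff.mp hσ.trace_nonneg).2
    apply Complex.ext <;> simp [← this]⟩
  have hs0 : 0 < s := by
    have h := lt_of_le_of_ne hσ.trace_nonneg h0.symm
    rw [hs] at h
    exact_mod_cast h
  have hS : S.IsHermitian := by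
    have h := (hσ.kronecker (.one : (1 : Matrix B B ℂ).PosSemidef)).isHermitian.sub h₂.isHermitian
    rwa [sub_sub_cancel] at h
  have hc : (0 : ℂ) ≤ (s : ℂ)⁻¹ := by
    rw [← Complex.ofReal_inv]
    exact_mod_cast (inv_pos.mpr hs0).le
  have hcS : ((s : ℂ)⁻¹ • S).IsHermitian := hS.smul (IsSelfAdjoint.of_nonneg hc)
  have hR := PTb_isHermitian hcS
  obtain ⟨r, hr⟩ : ∃ r : ℝ, (J * PTb ((s : ℂ)⁻¹ • S)).trace = r := ⟨_, Eq.symm <|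
    Complex.conj_eq_iff_re.mp (star_trace_mul_of_isHermitian hJ hR)⟩
  have hrt : r ≤ t := by
    refine ht ⟨PTb ((s : ℂ)⁻¹ • S), (s : ℂ)⁻¹ • σ, hR, hσ.smul hc, ?_, ?_, ?_, hr⟩
    · rw [Matrix.trace_smul, hs, smul_eq_mul, inv_mul_cancel₀ (hs ▸ h0)]
    · rw [PTb_PTb, Matrix.smul_kronecker, ← smul_neg, Loe, ← smul_sub]
      exact Matrix.PosSemidef.smul h₁ hc
    · rw [PTb_PTb, Matrix.smul_kronecker, Loe, ← smul_sub]
      exact Matrix.PosSemidef.smul h₂ hc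
  have hlin : PTb ((s : ℂ)⁻¹ • S) = (s : ℂ)⁻¹ • PTb S := rfl
  rw [hlin, Matrix.mul_smul, Matrix.trace_smul, smul_eq_mul] at hr
  have hsC : (s : ℂ) ≠ 0 := hs ▸ h0
  rw [inv_mul_eq_iff_eq_mul₀ hsC] at hr
  rw [hr, hs, mul_comm]
  exact_mod_cast mul_le_mul_of_nonneg_right hrt hs0.le

end Gamma

section TensorChannel

variable {A1 B1 A2 B2 : Type*}

/-- Regrouping `(A1 B1)(A2 B2)` into `(A1 A2)(B1 B2)`. -/
def regroup (M : Matrix ((A1 × A2) × (B1 × B2)) ((A1 × A2) × (B1 × B2)) ℂ) :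
    Matrix ((A1 × B1) × (A2 × B2)) ((A1 × B1) × (A2 × B2)) ℂ :=
  M.submatrix (Equiv.prodProdProdComm A1 B1 A2 B2) (Equiv.prodProdProdComm A1 B1 A2 B2)

theorem regroup_posSemidef {M : Matrix ((A1 × A2) × (B1 × B2)) ((A1 × A2) × (B1 × B2)) ℂ}
    (hM : M.PosSemidef) : (regroup M).PosSemidef := hM.submatrix _

theorem trace_mul_partialPairing [Fintype A1] [Fintype B1] [Fintype A2] [Fintype B2]
    (J1 : Matrix (A1 × B1) (A1 × B1) ℂ)
    (J2 : Matrix (A2 × B2) (A2 × B2) ℂ)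
    (W : Matrix ((A1 × A2) × (B1 × B2)) ((A1 × A2) × (B1 × B2)) ℂ) :
    (J1 * partialPairing J2 (regroup W)).trace = (choiTensor J1 J2 * W).trace := by
  have e : choiTensor J1 J2 * W = (J1 ⊗ₖ J2 * regroup W).submatrix
      (Equiv.prodProdProdComm A1 A2 B1 B2) (Equiv.prodProdProdComm A1 A2 B1 B2) := by
    rw [← Matrix.submatrix_mul_equiv _ _ _ (Equiv.prodProdProdComm A1 A2 B1 B2)]
    rfl
  have htr : (choiTensor J1 J2 * W).trace = (J1 ⊗ₖ J2 * regroup W).trace := by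
    rw [e]
    exact (Equiv.prodProdProdComm A1 A2 B1 B2).sum_comp
      (fun i => (J1 ⊗ₖ J2 * regroup W) i i)
  rw [htr]
  simp only [Matrix.trace, Matrix.diag, Matrix.mul_apply, Matrix.kroneckerMap_apply,
    partialPairing, Finset.mul_sum, ← Fintype.sum_prod_type']
  refine Fintype.sum_equiv
    ⟨fun p => ((p.1, p.2.2.1), (p.2.1, p.2.2.2)), fun p => (p.1.1, p.2.1, p.1.2, p.2.2),
      fun _ => rfl, fun _ => rfl⟩ _ _ fun _ => ?_
  simp only [Equiv.coe_fn_mk]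
  ring

theorem PTb_partialPairing_regroup [Fintype A2] [Fintype B2] (J2 : Matrix (A2 × B2) (A2 × B2) ℂ)
    (W : Matrix ((A1 × A2) × (B1 × B2)) ((A1 × A2) × (B1 × B2)) ℂ) :
    PTb (partialPairing J2 (regroup W)) = partialPairing (PTb J2) (regroup (PTb W)) := by
  ext y x
  simp only [PTb, partialPairing, ← Fintype.sum_prod_type']
  exact Fintype.sum_equiv
    ⟨fun p => ((p.1.1, p.2.2), (p.2.1, p.1.2)), fun p => ((p.1.1, p.2.2), (p.2.1, p.1.2)),
      fun _ => rfl, fun _ => rfl⟩ _ _ fun _ => rfl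

variable [DecidableEq B1] [DecidableEq B2]

theorem partialPairing_regroup_kronecker_one [Fintype A2] [Fintype B2] [DecidableEq A2]
    {J2 : Matrix (A2 × B2) (A2 × B2) ℂ} (hJ2TP : trB J2 = 1)
    (ρ : Matrix (A1 × A2) (A1 × A2) ℂ) :
    partialPairing J2 (regroup (ρ ⊗ₖ (1 : Matrix (B1 × B2) (B1 × B2) ℂ))) =
      trB ρ ⊗ₖ (1 : Matrix B1 B1 ℂ) := by
  ext ⟨a, b⟩ ⟨a', b'⟩
  have h := trace_mul_kronecker_one J2
    (Matrix.of fun c c' => ρ (a, c) (a', c') * (1 : Matrix B1 B1 ℂ) b b')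
  rw [hJ2TP, one_mul] at h
  have hl : partialPairing J2 (regroup (ρ ⊗ₖ (1 : Matrix (B1 × B2) (B1 × B2) ℂ)))
      (a, b) (a', b') = (J2 * ((Matrix.of fun c c' => ρ (a, c) (a', c') *
        (1 : Matrix B1 B1 ℂ) b b') ⊗ₖ (1 : Matrix B2 B2 ℂ))).trace := by
    simp only [partialPairing, regroup, Matrix.trace, Matrix.diag, Matrix.mul_apply,
      Matrix.submatrix_apply, Equiv.prodProdProdComm_apply, Matrix.kroneckerMap_apply,
      Matrix.of_apply]
    refine Finset.sum_congr rfl fun u _ => Finset.sum_congr rfl fun v _ => ?_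
    rw [← Matrix.one_kronecker_one, Matrix.kroneckerMap_apply]
    ring
  rw [hl, h]
  simp [Matrix.trace, trB, Finset.sum_mul]

theorem compress_regroup_kronecker_one [Fintype A1] [Fintype B1] (ρ : Matrix (A1 × A2) (A1 × A2) ℂ)
    (φ : A1 × B1 → ℂ) :
    compress φ (regroup (ρ ⊗ₖ (1 : Matrix (B1 × B2) (B1 × B2) ℂ))) =
      (∑ b, compress (fun a => φ (a, b)) ρ) ⊗ₖ (1 : Matrix B2 B2 ℂ) := by
  ext ⟨c, d⟩ ⟨c', d'⟩
  simp only [compress, regroup, Matrix.submatrix_apply, Equiv.prodProdProdComm_apply,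
    Matrix.kroneckerMap_apply, ← Matrix.one_kronecker_one, Matrix.sum_apply, Finset.sum_mul,
    Fintype.sum_prod_type]
  rw [Finset.sum_comm]
  refine Finset.sum_congr rfl fun b _ => Finset.sum_congr rfl fun a _ =>
    Finset.sum_congr rfl fun a' _ => ?_
  rw [Finset.sum_eq_single b]
  · rw [Matrix.one_apply_eq]
    ring
  · intro b' _ hb
    simp [Matrix.one_apply_ne hb.symm]
  · simp

theorem trace_sum_compress [Fintype A1] [Fintype B1] [Fintype A2]
    (ρ : Matrix (A1 × A2) (A1 × A2) ℂ) (φ : A1 × B1 → ℂ) :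
    (∑ b, compress (fun a => φ (a, b)) ρ).trace =
      star φ ⬝ᵥ ((trB ρ ⊗ₖ (1 : Matrix B1 B1 ℂ)) *ᵥ φ) := by
  simp only [Matrix.trace_sum, trace_compress, dotProduct, Matrix.mulVec, Fintype.sum_prod_type,
    Matrix.kroneckerMap_apply, Pi.star_apply, Matrix.one_apply, mul_ite, mul_one, mul_zero,
    ite_mul, zero_mul, Finset.sum_ite_eq, Finset.mem_univ, if_true]
  exact Finset.sum_comm

/-- Pairing `W` with `J2` costs a factor `Γ` in the bound on the partial transpose. -/
theorem partialPairing_PTb_le [Fintype A1] [Fintype B1] [Fintype A2] [Fintype B2]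
    {J2 : Matrix (A2 × B2) (A2 × B2) ℂ} (hJ2 : J2.IsHermitian)
    {t : ℝ} (ht : t ∈ upperBounds (GammaSet J2)) {c : ℂ} (hc : 0 ≤ c)
    {ρ : Matrix (A1 × A2) (A1 × A2) ℂ} (hρ : ρ.PosSemidef)
    {T : Matrix ((A1 × A2) × (B1 × B2)) ((A1 × A2) × (B1 × B2)) ℂ}
    (h₁ : Loe (-(c • (ρ ⊗ₖ (1 : Matrix (B1 × B2) (B1 × B2) ℂ)))) T)
    (h₂ : Loe T (c • (ρ ⊗ₖ (1 : Matrix (B1 × B2) (B1 × B2) ℂ)))) :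
    Loe (partialPairing (PTb J2) (regroup T))
      ((c * t) • (trB ρ ⊗ₖ (1 : Matrix B1 B1 ℂ))) := by
  refine posSemidef_of_dotProduct_mulVec_nonneg fun φ => ?_
  have hσ : (∑ b, compress (fun a => φ (a, b)) ρ).PosSemidef :=
    Matrix.posSemidef_sum _ fun b _ => compress_posSemidef hρ _
  have hcomp : compress φ (regroup (c • (ρ ⊗ₖ (1 : Matrix (B1 × B2) (B1 × B2) ℂ)))) =
      (c • ∑ b, compress (fun a => φ (a, b)) ρ) ⊗ₖ (1 : Matrix B2 B2 ℂ) := by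
    rw [Matrix.smul_kronecker, ← compress_regroup_kronecker_one, ← compress_smul]
    rfl
  have key := trace_mul_PTb_le hJ2 ht (S := compress φ (regroup T)) (hσ.smul hc)
    (by
      rw [← hcomp, Loe, ← compress_neg, ← compress_sub]
      exact compress_posSemidef (regroup_posSemidef h₁) φ)
    (by
      rw [← hcomp, Loe, ← compress_sub]
      exact compress_posSemidef (regroup_posSemidef h₂) φ)
  rw [Matrix.sub_mulVec, dotProduct_sub, dotProduct_partialPairing_mulVec, trace_PTb_mul,
    Matrix.smul_mulVec, dotProduct_smul, ← trace_sum_compress, sub_nonneg]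
  refine key.trans_eq ?_
  rw [Matrix.trace_smul, smul_eq_mul, smul_eq_mul]
  ring

end TensorChannel

/-- If `Γ(N2) = t`, then `F^{PPTp}(N1 ⊗ N2, k·t) ≤ F^{PPTp}(N1, k)` for all
`k > 0`. -/
theorem ppt_fidelity_gamma_bound
    {A1 B1 A2 B2 : Type*} [Fintype A1] [Fintype B1] [Fintype A2] [Fintype B2]
    [DecidableEq A1] [DecidableEq B1] [DecidableEq A2] [DecidableEq B2]
    (J1 : Matrix (A1 × B1) (A1 × B1) ℂ) (J2 : Matrix (A2 × B2) (A2 × B2) ℂ)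
    (hJ1 : J1.PosSemidef) (hJ1TP : trB J1 = 1)
    (hJ2 : J2.PosSemidef) (hJ2TP : trB J2 = 1)
    (t : ℝ) (ht : IsGreatest (GammaSet J2) t)
    (k : ℝ) (hk : 0 < k)
    (f1 f12 : ℝ)
    (hf1 : IsGreatest (FSet J1 k) f1)
    (hf12 : IsGreatest (FSet (choiTensor J1 J2) (k * t)) f12) :
    f12 ≤ f1 := by
  obtain ⟨W, ρ, hρ, hρ1, hW, hWρ, hlo, hhi, hf⟩ := hf12.1
  have ht1 := one_le_of_isGreatest_GammaSet hJ2TP ht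
  have ht0 : 0 < t := by linarith
  have hc : (0 : ℂ) ≤ ((k * t : ℝ) : ℂ)⁻¹ := by
    rw [← Complex.ofReal_inv]
    exact_mod_cast (inv_pos.mpr (mul_pos hk ht0)).le
  have hct : ((k * t : ℝ) : ℂ)⁻¹ * (t : ℂ) = (k : ℂ)⁻¹ := by
    have hkC : (k : ℂ) ≠ 0 := by exact_mod_cast hk.ne'
    have htC : (t : ℂ) ≠ 0 := by exact_mod_cast ht0.ne'
    push_cast
    field_simp
  refine hf1.2 ⟨partialPairing J2 (regroup W), trB ρ, trB_posSemidef hρ,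
    (trace_trB ρ).trans hρ1, partialPairing_posSemidef hJ2 (regroup_posSemidef hW),
    ?_, ?_, ?_, (trace_mul_partialPairing J1 J2 W).trans hf⟩
  · rw [← partialPairing_regroup_kronecker_one hJ2TP, Loe, ← partialPairing_sub]
    exact partialPairing_posSemidef hJ2 (regroup_posSemidef hWρ)
  · have h := partialPairing_PTb_le hJ2.isHermitian ht.2 hc hρ (T := -PTb W)
      (by rw [Loe, neg_sub_neg]; exact hhi)
      (by rw [Loe, sub_neg_eq_add, add_comm, ← sub_neg_eq_add]; exact hlo)
    have hneg : partialPairing (PTb J2) (regroup (-PTb W)) =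
        -partialPairing (PTb J2) (regroup (PTb W)) := by
      ext y x
      simp [partialPairing, regroup]
    rw [hct, hneg, Loe, sub_neg_eq_add, add_comm] at h
    rwa [PTb_partialPairing_regroup, Loe, sub_neg_eq_add]
  · have h := partialPairing_PTb_le hJ2.isHermitian ht.2 hc hρ hlo hhi
    rwa [hct, ← PTb_partialPairing_regroup] at h
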